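/- Let n ≥ 2, integers a ≥ 0, b ≥ 1 and 2 ≤ r ≤ n. Every p ∈ 𝒬_{a,b,r} admits a unique decomposition p = y + z̲̃† · q, where y ∈ 𝒬_{a,b,r} with ∂z̃† y = 0, q ∈ 𝒬_{a,b−1,r−1} with ∂z̃† q = 0, and z̲̃† · q denotes the pointwise left multiplication z ↦ z̲̃†(z) q(z) with z̲̃†(z) = Σ_{j=1}^{n−1} 𝔣_j† conj(z_j). (Fischer decomposition 𝒬_{a,b,r} = (Ker ∂z̃† ∩ 𝒬_{a,b,r}) ⊕ z̲̃† (Ker ∂z̃† ∩ 𝒬_{a,b−1,r−1}).) -/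

import Mathlib

noncomputable section

/-- The negative definite quadratic form `-∑ vᵢ²` on `K^m`. -/
def negQ (K : Type) [Field K] (m : ℕ) : QuadraticForm K (Fin m → K) :=
  QuadraticMap.weightedSumSquares K (fun _ : Fin m => (-1 : K))

/-- The complex Clifford algebra `ℂ_{2n}`, generated by `e_1, …, e_{2n}` with
`e_α e_β + e_β e_α = -2 δ_{αβ}`. -/
abbrev Cl (n : ℕ) : Type := CliffordAlgebra (negQ ℂ (n + n))

/-- The generators `e_α`, `α = 1, …, 2n`, of `ℂ_{2n}`. -/
def e (n : ℕ) (α : Fin (n + n)) : Cl n := CliffordAlgebra.ι (negQ ℂ (n + n)) (Pi.single α 1)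

/-- The Witt basis element `𝔣_j = ½(e_j - i e_{n+j})`. -/
def ff (n : ℕ) (j : Fin n) : Cl n :=
  (2⁻¹ : ℂ) • (e n (Fin.castAdd n j) - Complex.I • e n (Fin.natAdd n j))

/-- The Witt basis element `𝔣_j† = -½(e_j + i e_{n+j})`. -/
def ffd (n : ℕ) (j : Fin n) : Cl n :=
  -((2⁻¹ : ℂ) • (e n (Fin.castAdd n j) + Complex.I • e n (Fin.natAdd n j)))

/-- `f : ℂ^m → ℂ_{2n}` has directional derivative `d` at `z` in direction `v`
(componentwise, i.e. tested against all linear functionals on the finite-dimensional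
space `ℂ_{2n}`; here `ℂ^m` is regarded as the real vector space `ℝ^{2m}`). -/
def HasDirDeriv {n m : ℕ} (f : (Fin m → ℂ) → Cl n) (z v : Fin m → ℂ) (d : Cl n) : Prop :=
  ∀ φ : Cl n →ₗ[ℂ] ℂ, HasDerivAt (fun t : ℝ => φ (f (z + t • v))) (φ d) 0

/-- The directional derivative of `f` at `z` in direction `v` (junk value if none exists). -/
def dirDeriv {n m : ℕ} (f : (Fin m → ℂ) → Cl n) (v : Fin m → ℂ) (z : Fin m → ℂ) : Cl n :=
  letI : Nonempty (Cl n) := ⟨0⟩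
  Classical.epsilon fun d => HasDirDeriv f z v d

/-- The Cauchy–Riemann operator `∂_{z_j} = ½(∂_{x_j} - i ∂_{y_j})`. -/
def pz {n m : ℕ} (j : Fin m) (f : (Fin m → ℂ) → Cl n) : (Fin m → ℂ) → Cl n := fun z =>
  (2⁻¹ : ℂ) • (dirDeriv f (Pi.single j 1) z - Complex.I • dirDeriv f (Pi.single j Complex.I) z)

/-- The conjugate Cauchy–Riemann operator `∂_{z_j^c} = ½(∂_{x_j} + i ∂_{y_j})`. -/
def pzc {n m : ℕ} (j : Fin m) (f : (Fin m → ℂ) → Cl n) : (Fin m → ℂ) → Cl n := fun z =>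
  (2⁻¹ : ℂ) • (dirDeriv f (Pi.single j 1) z + Complex.I • dirDeriv f (Pi.single j Complex.I) z)

/-- The Hermitean Dirac operator `∂_z g = ∑_j 𝔣_j† ∂_{z_j} g` on functions `ℂ^n → ℂ_{2n}`. -/
def dzFull (n : ℕ) (g : (Fin n → ℂ) → Cl n) (z : Fin n → ℂ) : Cl n :=
  ∑ j : Fin n, ffd n j * pz j g z

/-- The Hermitean Dirac operator `∂_z† g = ∑_j 𝔣_j ∂_{z_j^c} g` on functions `ℂ^n → ℂ_{2n}`. -/
def dzdFull (n : ℕ) (g : (Fin n → ℂ) → Cl n) (z : Fin n → ℂ) : Cl n :=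
  ∑ j : Fin n, ff n j * pzc j g z

/-- `g : ℂ^n → ℂ_{2n}` is Hermitean monogenic (everywhere). -/
def HMonogenic (n : ℕ) (g : (Fin n → ℂ) → Cl n) : Prop :=
  ∀ z, dzFull n g z = 0 ∧ dzdFull n g z = 0

/-- The restricted Hermitean Dirac operator `∂_z̃ g = ∑_{j<n} 𝔣_j† ∂_{z_j} g` on functions
`ℂ^{n-1} → ℂ_{2n}`. -/
def dzT (n : ℕ) (g : (Fin (n - 1) → ℂ) → Cl n) (z : Fin (n - 1) → ℂ) : Cl n :=
  ∑ j : Fin (n - 1), ffd n (Fin.castLE (Nat.sub_le n 1) j) * pz j g z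

/-- The restricted Hermitean Dirac operator `∂_z̃† g = ∑_{j<n} 𝔣_j ∂_{z_j^c} g` on functions
`ℂ^{n-1} → ℂ_{2n}`. -/
def dzdT (n : ℕ) (g : (Fin (n - 1) → ℂ) → Cl n) (z : Fin (n - 1) → ℂ) : Cl n :=
  ∑ j : Fin (n - 1), ff n (Fin.castLE (Nat.sub_le n 1) j) * pzc j g z

/-- `p : ℂ^m → ℂ_{2n}` is a polynomial map (in the underlying real coordinates,
equivalently in `z_j` and their conjugates) with coefficients in `ℂ_{2n}`. -/
def IsPolyMap (n m : ℕ) (p : (Fin m → ℂ) → Cl n) : Prop :=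
  ∃ (N : ℕ) (c : Fin N → Cl n) (dx dy : Fin N → Fin m → ℕ),
    ∀ z, p z = ∑ t, (∏ j, (z j) ^ dx t j * (starRingEnd ℂ) (z j) ^ dy t j) • c t

/-- `p : ℂ^m → ℂ_{2n}` is a homogeneous polynomial of bidegree `(a, b)`:
it is polynomial and `p (c z) = c^a (conj c)^b p(z)`. -/
def IsBihom (n m a b : ℕ) (p : (Fin m → ℂ) → Cl n) : Prop :=
  IsPolyMap n m p ∧ ∀ (c : ℂ) (z : Fin m → ℂ),
    p (c • z) = (c ^ a * (starRingEnd ℂ) c ^ b) • p z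

/-- The idempotent `I = (𝔣_1 𝔣_1†)(𝔣_2 𝔣_2†) ⋯ (𝔣_n 𝔣_n†)`. -/
def Iel (n : ℕ) : Cl n := ((List.finRange n).map (fun j => ff n j * ffd n j)).prod

/-- The element `𝔣_{k_1}† ⋯ 𝔣_{k_r}† I` for `s = {k_1 < ⋯ < k_r}`. -/
def blade (n : ℕ) (s : Finset (Fin n)) : Cl n :=
  ((s.sort (· ≤ ·)).map (ffd n)).prod * Iel n

/-- The homogeneous part `(∧_n†)^{(r)} I` of spinor space. -/
def Lam (n r : ℕ) : Submodule ℂ (Cl n) :=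
  Submodule.span ℂ {x | ∃ s : Finset (Fin n), s.card = r ∧ x = blade n s}

/-- The subspace `(∧_{n-1}†)^{(r)}(𝔣_1†,…,𝔣_{n-1}†) I` (all indices `≤ n-1`). -/
def LamT (n r : ℕ) : Submodule ℂ (Cl n) :=
  Submodule.span ℂ
    {x | ∃ s : Finset (Fin n), s.card = r ∧ (∀ j ∈ s, (j : ℕ) + 1 < n) ∧ x = blade n s}

/-- The subspace `(∧_{n-1}†)^{(r-1)}(𝔣_1†,…,𝔣_{n-1}†) 𝔣_n† I`: the span of the blades
`𝔣_{k_1}† ⋯ 𝔣_{k_{r-1}}† 𝔣_n† I` with `k_1 < ⋯ < k_{r-1} ≤ n-1`, i.e. of the `r`-blades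
whose index set contains `n`. -/
def LamQ (n r : ℕ) : Submodule ℂ (Cl n) :=
  Submodule.span ℂ
    {x | ∃ s : Finset (Fin n), s.card = r ∧ (∃ j ∈ s, (j : ℕ) + 1 = n) ∧ x = blade n s}

/-- The embedding `ℂ^{n-1} ≃ {z ∈ ℂ^n : z_n = 0} ⊆ ℂ^n`. -/
def embC (n : ℕ) (x : Fin (n - 1) → ℂ) : Fin n → ℂ :=
  fun i => if h : (i : ℕ) < n - 1 then x ⟨i, h⟩ else 0

section Witt

variable {n : ℕ}

theorem e_mul_e_add (α β : Fin (n + n)) :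
    e n α * e n β + e n β * e n α = if α = β then -2 else 0 := by
  have hpol : QuadraticMap.polar (negQ ℂ (n + n)) (Pi.single α 1) (Pi.single β 1) =
      if α = β then -2 else 0 := by
    rw [QuadraticMap.polar]
    simp only [negQ, QuadraticMap.weightedSumSquares_apply]
    rw [← Finset.sum_sub_distrib, ← Finset.sum_sub_distrib]
    have h : ∀ i : Fin (n + n),
        ((-1 : ℂ) • ((Pi.single α 1 + Pi.single β 1 : Fin (n + n) → ℂ) i *
            (Pi.single α 1 + Pi.single β 1 : Fin (n + n) → ℂ) i) -
          (-1 : ℂ) • ((Pi.single α 1 : Fin (n + n) → ℂ) i * (Pi.single α 1 : Fin (n + n) → ℂ) i)) -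
          (-1 : ℂ) • ((Pi.single β 1 : Fin (n + n) → ℂ) i * (Pi.single β 1 : Fin (n + n) → ℂ) i) =
        if i = α then (if α = β then -2 else 0) else 0 := by
      intro i
      simp only [Pi.add_apply, Pi.single_apply, smul_eq_mul]
      split_ifs <;> first | (exfalso; subst_vars; contradiction) | ring
    rw [Finset.sum_congr rfl fun i _ => h i, Finset.sum_ite_eq' Finset.univ α]
    simp
  unfold e
  rw [CliffordAlgebra.ι_mul_ι_add_swap, hpol]
  split_ifs
  · rw [map_neg, map_ofNat]
  · rw [map_zero]

theorem isotropic_mul_add (s t : ℂ) (j k : Fin n) :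
    (e n (Fin.castAdd n j) + s • e n (Fin.natAdd n j)) *
        (e n (Fin.castAdd n k) + t • e n (Fin.natAdd n k)) +
      (e n (Fin.castAdd n k) + t • e n (Fin.natAdd n k)) *
        (e n (Fin.castAdd n j) + s • e n (Fin.natAdd n j)) =
      if j = k then (-2 * (1 + s * t)) • (1 : Cl n) else 0 := by
  have h1 := e_mul_e_add (Fin.castAdd n j) (Fin.castAdd n k)
  have h2 := e_mul_e_add (Fin.natAdd n j) (Fin.natAdd n k)
  have h3 := e_mul_e_add (Fin.castAdd n j) (Fin.natAdd n k)
  have h4 := e_mul_e_add (Fin.natAdd n j) (Fin.castAdd n k)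
  rw [if_neg (by simp only [Fin.ext_iff, Fin.val_castAdd, Fin.val_natAdd]; omega)] at h3 h4
  simp only [Fin.castAdd_inj, Fin.natAdd_inj] at h1 h2
  have key : (e n (Fin.castAdd n j) + s • e n (Fin.natAdd n j)) *
        (e n (Fin.castAdd n k) + t • e n (Fin.natAdd n k)) +
      (e n (Fin.castAdd n k) + t • e n (Fin.natAdd n k)) *
        (e n (Fin.castAdd n j) + s • e n (Fin.natAdd n j)) =
      (e n (Fin.castAdd n j) * e n (Fin.castAdd n k) +
        e n (Fin.castAdd n k) * e n (Fin.castAdd n j)) +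
      (s * t) • (e n (Fin.natAdd n j) * e n (Fin.natAdd n k) +
        e n (Fin.natAdd n k) * e n (Fin.natAdd n j)) +
      t • (e n (Fin.castAdd n j) * e n (Fin.natAdd n k) +
        e n (Fin.natAdd n k) * e n (Fin.castAdd n j)) +
      s • (e n (Fin.natAdd n j) * e n (Fin.castAdd n k) +
        e n (Fin.castAdd n k) * e n (Fin.natAdd n j)) := by
    simp only [smul_mul_assoc, mul_smul_comm, add_mul, mul_add, smul_add, smul_smul]
    module
  rw [key, h1, h2, h3, h4, smul_zero, smul_zero, add_zero, add_zero]
  split_ifs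
  · have h : (-2 : Cl n) = (-2 : ℂ) • (1 : Cl n) := by
      rw [neg_smul, ofNat_smul_eq_nsmul ℂ 2 (1 : Cl n), nsmul_one, Nat.cast_ofNat]
    rw [h]
    module
  · simp

theorem ff_mul_ff_add (j k : Fin n) : ff n j * ff n k + ff n k * ff n j = 0 := by
  have h := isotropic_mul_add (-Complex.I) (-Complex.I) j k
  rw [neg_mul_neg, Complex.I_mul_I, add_neg_cancel, mul_zero, zero_smul, ite_self] at h
  simp only [neg_smul, ← sub_eq_add_neg] at h
  rw [ff, ff, smul_mul_smul_comm, smul_mul_smul_comm, ← smul_add, h, smul_zero]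

theorem ffd_mul_ffd_add (j k : Fin n) : ffd n j * ffd n k + ffd n k * ffd n j = 0 := by
  have h := isotropic_mul_add Complex.I Complex.I j k
  rw [Complex.I_mul_I, add_neg_cancel, mul_zero, zero_smul, ite_self] at h
  rw [ffd, ffd, neg_mul_neg, neg_mul_neg, smul_mul_smul_comm, smul_mul_smul_comm, ← smul_add, h,
    smul_zero]

theorem ff_mul_ffd_add (j k : Fin n) :
    ff n j * ffd n k + ffd n k * ff n j = if j = k then 1 else 0 := by
  have h := isotropic_mul_add (-Complex.I) Complex.I j k
  rw [neg_mul Complex.I, Complex.I_mul_I] at h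
  simp only [neg_smul, ← sub_eq_add_neg] at h
  rw [ff, ffd, neg_mul, mul_neg, smul_mul_smul_comm, smul_mul_smul_comm, ← neg_add, ← smul_add, h]
  split_ifs
  · rw [smul_smul, ← neg_smul]
    norm_num
  · rw [smul_zero, neg_zero]

theorem eq_zero_of_add_self {x : Cl n} (h : x + x = 0) : x = 0 := by
  rw [← two_smul ℂ x] at h
  exact (smul_eq_zero.mp h).resolve_left two_ne_zero

theorem ff_mul_self (j : Fin n) : ff n j * ff n j = 0 :=
  eq_zero_of_add_self (ff_mul_ff_add j j)

theorem ffd_mul_self (j : Fin n) : ffd n j * ffd n j = 0 :=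
  eq_zero_of_add_self (ffd_mul_ffd_add j j)

/-- The element `𝔣_{k_1}† ⋯ 𝔣_{k_r}† I` for an arbitrary list of indices. -/
def listBlade (l : List (Fin n)) : Cl n := (l.map (ffd n)).prod * Iel n

theorem listBlade_cons (j : Fin n) (l : List (Fin n)) :
    listBlade (j :: l) = ffd n j * listBlade l := by
  simp [listBlade, mul_assoc]

theorem ff_mul_prod_eq_zero (j : Fin n) (l : List (Fin n)) (hj : j ∈ l) :
    ff n j * (l.map fun k => ff n k * ffd n k).prod = 0 := by
  induction l with
  | nil => simp at hj
  | cons k l ih =>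
    rw [List.map_cons, List.prod_cons]
    by_cases h : j = k
    · subst h
      rw [← mul_assoc, ← mul_assoc, ff_mul_self, zero_mul, zero_mul]
    · have h1 := eq_neg_of_add_eq_zero_left (ff_mul_ff_add j k)
      have h2 := ff_mul_ffd_add j k
      rw [if_neg h] at h2
      have h3 := eq_neg_of_add_eq_zero_left h2
      rw [← mul_assoc, ← mul_assoc, h1, neg_mul, mul_assoc (ff n k), h3, mul_neg, neg_neg,
        ← mul_assoc, mul_assoc _ (ff n j), ih ((List.mem_cons.mp hj).resolve_left h), mul_zero]

theorem ff_mul_Iel (j : Fin n) : ff n j * Iel n = 0 :=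
  ff_mul_prod_eq_zero j _ (List.mem_finRange j)

theorem ff_mul_listBlade_of_notMem (j : Fin n) (l : List (Fin n)) (hj : j ∉ l) :
    ff n j * listBlade l = 0 := by
  induction l with
  | nil => simpa [listBlade] using ff_mul_Iel j
  | cons k l ih =>
    rw [List.mem_cons, not_or] at hj
    have h2 := ff_mul_ffd_add j k
    rw [if_neg hj.1] at h2
    rw [listBlade_cons, ← mul_assoc, eq_neg_of_add_eq_zero_left h2, neg_mul, mul_assoc, ih hj.2,
      mul_zero, neg_zero]

theorem listBlade_perm {l l' : List (Fin n)} (h : l.Perm l') :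
    listBlade l = listBlade l' ∨ listBlade l = -listBlade l' := by
  induction h with
  | nil => exact Or.inl rfl
  | cons k _ ih =>
    rw [listBlade_cons, listBlade_cons]
    rcases ih with ih | ih
    · exact Or.inl (by rw [ih])
    · exact Or.inr (by rw [ih, mul_neg])
  | swap j k l =>
    refine Or.inr ?_
    rw [listBlade_cons, listBlade_cons, listBlade_cons, listBlade_cons, ← mul_assoc, ← mul_assoc,
      eq_neg_of_add_eq_zero_left (ffd_mul_ffd_add k j), neg_mul]
  | trans _ _ ih1 ih2 =>
    rcases ih1 with h1 | h1 <;> rcases ih2 with h2 | h2 <;> simp [h1, h2]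

theorem listBlade_eq_cons_erase {j : Fin n} {l : List (Fin n)} (hj : j ∈ l) :
    listBlade l = ffd n j * listBlade (l.erase j) ∨
      listBlade l = -(ffd n j * listBlade (l.erase j)) := by
  rw [← listBlade_cons]
  exact listBlade_perm (List.perm_cons_erase hj)

theorem ff_mul_ffd_mul_listBlade {j : Fin n} {l : List (Fin n)} (hj : j ∉ l) :
    ff n j * (ffd n j * listBlade l) = listBlade l := by
  have h := ff_mul_ffd_add j j
  rw [if_pos rfl] at h
  rw [← mul_assoc, eq_sub_of_add_eq h, sub_mul, one_mul, mul_assoc,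
    ff_mul_listBlade_of_notMem j l hj, mul_zero, sub_zero]

theorem ffd_mul_listBlade_of_mem {j : Fin n} {l : List (Fin n)} (hj : j ∈ l) :
    ffd n j * listBlade l = 0 := by
  rcases listBlade_eq_cons_erase hj with h | h <;> simp [h, ← mul_assoc, ffd_mul_self]

theorem listBlade_mem_LamQ {r : ℕ} {l : List (Fin n)} (hl : l.Nodup) (hr : l.length = r)
    (hlast : ∃ j ∈ l, (j : ℕ) + 1 = n) : listBlade l ∈ LamQ n r := by
  have hp : l.Perm (l.toFinset.sort (· ≤ ·)) := by
    rw [List.perm_ext_iff_of_nodup hl (Finset.sort_nodup _ _)]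
    simp
  have hb : blade n l.toFinset ∈ LamQ n r :=
    Submodule.subset_span ⟨l.toFinset, by rw [List.toFinset_card_of_nodup hl, hr],
      by simpa using hlast, rfl⟩
  rcases listBlade_perm hp with h | h
  · rw [h]
    exact hb
  · rw [h]
    exact neg_mem hb

theorem LamQ_induction {r : ℕ} {P : Cl n → Prop} (hzero : P 0)
    (hadd : ∀ x y, P x → P y → P (x + y)) (hsmul : ∀ (c : ℂ) x, P x → P (c • x))
    (hblade : ∀ l : List (Fin n), l.Nodup → l.length = r → (∃ j ∈ l, (j : ℕ) + 1 = n) →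
      P (listBlade l)) {x : Cl n} (hx : x ∈ LamQ n r) : P x := by
  induction hx using Submodule.span_induction with
  | mem x hx =>
    obtain ⟨s, hs, hlast, rfl⟩ := hx
    exact hblade (s.sort (· ≤ ·)) (Finset.sort_nodup _ _) (by simpa using hs) (by simpa using hlast)
  | zero => exact hzero
  | add x y _ _ hx hy => exact hadd x y hx hy
  | smul c x _ hx => exact hsmul c x hx

theorem ffd_mul_mem_LamQ {r : ℕ} (j : Fin n) {x : Cl n} (hx : x ∈ LamQ n r) :
    ffd n j * x ∈ LamQ n (r + 1) := by
  refine LamQ_induction (P := fun x => ffd n j * x ∈ LamQ n (r + 1)) ?_ ?_ ?_ ?_ hx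
  · simp
  · intro x y hx hy
    rw [mul_add]
    exact add_mem hx hy
  · intro c x hx
    rw [mul_smul_comm]
    exact Submodule.smul_mem _ _ hx
  · intro l hl hr ⟨k, hk, hkn⟩
    by_cases hj : j ∈ l
    · rw [ffd_mul_listBlade_of_mem hj]
      exact zero_mem _
    · rw [← listBlade_cons]
      exact listBlade_mem_LamQ (List.nodup_cons.mpr ⟨hj, hl⟩) (by simp [hr])
        ⟨k, List.mem_cons_of_mem _ hk, hkn⟩

theorem ff_mul_mem_LamQ {r : ℕ} {j : Fin n} (hjn : (j : ℕ) + 1 < n) {x : Cl n}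
    (hx : x ∈ LamQ n r) : ff n j * x ∈ LamQ n (r - 1) := by
  refine LamQ_induction (P := fun x => ff n j * x ∈ LamQ n (r - 1)) ?_ ?_ ?_ ?_ hx
  · simp
  · intro x y hx hy
    rw [mul_add]
    exact add_mem hx hy
  · intro c x hx
    rw [mul_smul_comm]
    exact Submodule.smul_mem _ _ hx
  · intro l hl hr ⟨k, hk, hkn⟩
    by_cases hj : j ∈ l
    · have hkj : k ≠ j := by
        rintro rfl
        omega
      have hmem : listBlade (l.erase j) ∈ LamQ n (r - 1) :=
        listBlade_mem_LamQ (hl.erase j) (by rw [List.length_erase_of_mem hj, hr])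
          ⟨k, (List.mem_erase_of_ne hkj).mpr hk, hkn⟩
      have hjl : j ∉ l.erase j := hl.not_mem_erase
      rcases listBlade_eq_cons_erase hj with h | h
      · rw [h, ff_mul_ffd_mul_listBlade hjl]
        exact hmem
      · rw [h, mul_neg, ff_mul_ffd_mul_listBlade hjl]
        exact neg_mem hmem
    · rw [ff_mul_listBlade_of_notMem j l hj]
      exact zero_mem _

theorem sum_ff_mul_ffd_mul {r : ℕ} {x : Cl n} (hx : x ∈ LamQ n r) :
    ∑ j : Fin (n - 1), ff n (Fin.castLE (Nat.sub_le n 1) j) *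
      (ffd n (Fin.castLE (Nat.sub_le n 1) j) * x) = (n - r) • x := by
  refine LamQ_induction (P := fun x => ∑ j : Fin (n - 1), ff n (Fin.castLE (Nat.sub_le n 1) j) *
      (ffd n (Fin.castLE (Nat.sub_le n 1) j) * x) = (n - r) • x) ?_ ?_ ?_ ?_ hx
  · simp
  · intro x y hx hy
    simp only [mul_add, Finset.sum_add_distrib, hx, hy, smul_add]
  · intro c x hx
    simp only [mul_smul_comm, ← Finset.smul_sum, hx]
    exact smul_comm _ _ _
  · intro l hl hr ⟨k, hk, hkn⟩
    have hterm : ∀ j : Fin n, ff n j * (ffd n j * listBlade l) =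
        if j ∈ l.toFinset then 0 else listBlade l := by
      intro j
      split_ifs with h
      · rw [ffd_mul_listBlade_of_mem (List.mem_toFinset.mp h), mul_zero]
      · exact ff_mul_ffd_mul_listBlade (by simpa using h)
    have hsum : ∑ j : Fin n, ff n j * (ffd n j * listBlade l) = (n - r) • listBlade l := by
      simp only [hterm]
      rw [Finset.sum_ite, Finset.sum_const_zero, zero_add, Finset.sum_const]
      congr 1
      rw [Finset.filter_not, Finset.filter_mem_eq_inter, Finset.univ_inter,
        Finset.card_sdiff_of_subset (Finset.subset_univ _), Finset.card_univ, Fintype.card_fin,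
        List.toFinset_card_of_nodup hl, hr]
    rw [← hsum]
    obtain ⟨m, rfl⟩ : ∃ m, n = m + 1 := ⟨n - 1, by omega⟩
    rw [Fin.sum_univ_castSucc]
    have hlast : Fin.last m = k := Fin.ext (by simp; omega)
    rw [hlast, hterm k, if_pos (List.mem_toFinset.mpr hk), add_zero]
    rfl

end Witt

section Derivatives

variable {n m : ℕ}

theorem HasDirDeriv.unique {f : (Fin m → ℂ) → Cl n} {z v : Fin m → ℂ} {d d' : Cl n}
    (h : HasDirDeriv f z v d) (h' : HasDirDeriv f z v d') : d = d' := by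
  rw [← sub_eq_zero, ← Module.forall_dual_apply_eq_zero_iff ℂ]
  intro φ
  rw [map_sub, (h φ).unique (h' φ), sub_self]

theorem HasDirDeriv.dirDeriv_eq {f : (Fin m → ℂ) → Cl n} {z v : Fin m → ℂ} {d : Cl n}
    (h : HasDirDeriv f z v d) : dirDeriv f v z = d :=
  HasDirDeriv.unique (Classical.epsilon_spec (p := fun d => HasDirDeriv f z v d) ⟨d, h⟩) h

theorem HasDirDeriv.zero (z v : Fin m → ℂ) :
    HasDirDeriv (0 : (Fin m → ℂ) → Cl n) z v 0 := by
  intro φ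
  simpa using hasDerivAt_const (0 : ℝ) (0 : ℂ)

theorem HasDirDeriv.add {f g : (Fin m → ℂ) → Cl n} {z v : Fin m → ℂ} {d d' : Cl n}
    (h : HasDirDeriv f z v d) (h' : HasDirDeriv g z v d') : HasDirDeriv (f + g) z v (d + d') := by
  intro φ
  simpa using (h φ).fun_add (h' φ)

theorem HasDirDeriv.mul_left {f : (Fin m → ℂ) → Cl n} {z v : Fin m → ℂ} {d : Cl n} (x : Cl n)
    (h : HasDirDeriv f z v d) : HasDirDeriv (fun w => x * f w) z v (x * d) :=
  fun φ => h (φ ∘ₗ LinearMap.mulLeft ℂ x)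

theorem HasDirDeriv.smul_fun {u : (Fin m → ℂ) → ℂ} {u' : ℂ} {f : (Fin m → ℂ) → Cl n}
    {z v : Fin m → ℂ} {d : Cl n} (hu : HasDerivAt (fun t : ℝ => u (z + t • v)) u' 0)
    (h : HasDirDeriv f z v d) :
    HasDirDeriv (fun w => u w • f w) z v (u' • f z + u z • d) := by
  intro φ
  simpa using hu.fun_mul (h φ)

theorem HasDirDeriv.mem {f : (Fin m → ℂ) → Cl n} {z v : Fin m → ℂ} {d : Cl n}
    (h : HasDirDeriv f z v d) {W : Submodule ℂ (Cl n)} (hf : ∀ w, f w ∈ W) : d ∈ W := by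
  by_contra hd
  obtain ⟨φ, hφ, hW⟩ := Submodule.exists_dual_map_eq_bot_of_notMem hd inferInstance
  have h0 : ∀ w, φ (f w) = 0 := fun w => by
    have := Submodule.mem_map_of_mem (f := φ) (hf w)
    rwa [hW, Submodule.mem_bot] at this
  have h1 := h φ
  simp only [h0] at h1
  exact hφ (h1.unique (hasDerivAt_const _ _))

/-- `f` has conjugate Cauchy–Riemann derivative `∂_{z_j^c} f = d` at `z`. -/
def HasPzc (j : Fin m) (f : (Fin m → ℂ) → Cl n) (z : Fin m → ℂ) (d : Cl n) : Prop :=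
  ∃ d₁ d₂, HasDirDeriv f z (Pi.single j 1) d₁ ∧ HasDirDeriv f z (Pi.single j Complex.I) d₂ ∧
    d = (2⁻¹ : ℂ) • (d₁ + Complex.I • d₂)

theorem HasPzc.pzc_eq {j : Fin m} {f : (Fin m → ℂ) → Cl n} {z : Fin m → ℂ} {d : Cl n}
    (h : HasPzc j f z d) : pzc j f z = d := by
  obtain ⟨d₁, d₂, h₁, h₂, rfl⟩ := h
  rw [pzc, h₁.dirDeriv_eq, h₂.dirDeriv_eq]

theorem HasPzc.zero (j : Fin m) (z : Fin m → ℂ) : HasPzc j (0 : (Fin m → ℂ) → Cl n) z 0 :=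
  ⟨0, 0, HasDirDeriv.zero _ _, HasDirDeriv.zero _ _, by simp⟩

theorem HasPzc.add {j : Fin m} {f g : (Fin m → ℂ) → Cl n} {z : Fin m → ℂ} {d d' : Cl n}
    (h : HasPzc j f z d) (h' : HasPzc j g z d') : HasPzc j (f + g) z (d + d') := by
  obtain ⟨d₁, d₂, h₁, h₂, rfl⟩ := h
  obtain ⟨d₁', d₂', h₁', h₂', rfl⟩ := h'
  exact ⟨_, _, h₁.add h₁', h₂.add h₂', by module⟩

theorem HasPzc.mul_left {j : Fin m} {f : (Fin m → ℂ) → Cl n} {z : Fin m → ℂ} {d : Cl n} (x : Cl n)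
    (h : HasPzc j f z d) : HasPzc j (fun w => x * f w) z (x * d) := by
  obtain ⟨d₁, d₂, h₁, h₂, rfl⟩ := h
  exact ⟨_, _, h₁.mul_left x, h₂.mul_left x, by simp only [mul_smul_comm, mul_add]⟩

theorem HasPzc.smul_fun {j : Fin m} {u : (Fin m → ℂ) → ℂ} {u₁ u₂ : ℂ} {f : (Fin m → ℂ) → Cl n}
    {z : Fin m → ℂ} {d : Cl n}
    (hu₁ : HasDerivAt (fun t : ℝ => u (z + t • (Pi.single j 1 : Fin m → ℂ))) u₁ 0)
    (hu₂ : HasDerivAt (fun t : ℝ => u (z + t • (Pi.single j Complex.I : Fin m → ℂ))) u₂ 0)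
    (h : HasPzc j f z d) :
    HasPzc j (fun w => u w • f w) z (((2⁻¹ : ℂ) * (u₁ + Complex.I * u₂)) • f z + u z • d) := by
  obtain ⟨d₁, d₂, h₁, h₂, rfl⟩ := h
  exact ⟨_, _, h₁.smul_fun hu₁, h₂.smul_fun hu₂, by module⟩

theorem HasPzc.smul {j : Fin m} {f : (Fin m → ℂ) → Cl n} {z : Fin m → ℂ} {d : Cl n} (c : ℂ)
    (h : HasPzc j f z d) : HasPzc j (c • f) z (c • d) := by
  have := h.smul_fun (u := fun _ => c) (hasDerivAt_const _ _) (hasDerivAt_const _ _)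
  simp only [mul_zero, add_zero, zero_smul, zero_add] at this
  exact this

theorem HasPzc.sum {ι : Type*} {j : Fin m} {f : ι → (Fin m → ℂ) → Cl n} {z : Fin m → ℂ}
    {d : ι → Cl n} (s : Finset ι) (h : ∀ i ∈ s, HasPzc j (f i) z (d i)) :
    HasPzc j (∑ i ∈ s, f i) z (∑ i ∈ s, d i) := by
  classical
  induction s using Finset.induction_on with
  | empty => simpa using HasPzc.zero j z
  | insert i s hi ih =>
    rw [Finset.sum_insert hi, Finset.sum_insert hi]
    exact (h i (Finset.mem_insert_self i s)).add
      (ih fun k hk => h k (Finset.mem_insert_of_mem hk))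

theorem HasPzc.mem {j : Fin m} {f : (Fin m → ℂ) → Cl n} {z : Fin m → ℂ} {d : Cl n}
    (h : HasPzc j f z d) {W : Submodule ℂ (Cl n)} (hf : ∀ w, f w ∈ W) : d ∈ W := by
  obtain ⟨d₁, d₂, h₁, h₂, rfl⟩ := h
  exact W.smul_mem _ (W.add_mem (h₁.mem hf) (W.smul_mem _ (h₂.mem hf)))

theorem hasDerivAt_coord (z v : Fin m → ℂ) (k : Fin m) :
    HasDerivAt (fun t : ℝ => (z + t • v) k) (v k) 0 := by
  simpa using ((hasDerivAt_id (0 : ℝ)).smul_const (v k)).const_add (z k)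

theorem hasDerivAt_conj_coord (z v : Fin m → ℂ) (k : Fin m) :
    HasDerivAt (fun t : ℝ => (starRingEnd ℂ) ((z + t • v) k)) ((starRingEnd ℂ) (v k)) 0 := by
  simpa using (hasDerivAt_coord z v k).star

theorem HasPzc.conj_smul {j : Fin m} {f : (Fin m → ℂ) → Cl n} {z : Fin m → ℂ} {d : Cl n}
    (k : Fin m) (h : HasPzc j f z d) :
    HasPzc j (fun w => (starRingEnd ℂ) (w k) • f w) z
      ((if k = j then f z else 0) + (starRingEnd ℂ) (z k) • d) := by
  convert h.smul_fun (u := fun w => (starRingEnd ℂ) (w k)) (hasDerivAt_conj_coord z _ k)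
    (hasDerivAt_conj_coord z _ k) using 2
  by_cases hk : k = j
  · subst hk
    simp only [if_true, Pi.single_eq_same, map_one, Complex.conj_I, mul_neg, Complex.I_mul_I]
    norm_num
  · simp [hk]

/-- The monomial `∏ z_j ^ α_j * conj z_j ^ β_j`. -/
def monom (α β : Fin m → ℕ) (z : Fin m → ℂ) : ℂ :=
  ∏ j, z j ^ α j * (starRingEnd ℂ) (z j) ^ β j

theorem monom_eq_mul_prod_erase (α β : Fin m → ℕ) (j : Fin m) (z : Fin m → ℂ) :
    monom α β z = z j ^ α j * (starRingEnd ℂ) (z j) ^ β j *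
      ∏ k ∈ Finset.univ.erase j, z k ^ α k * (starRingEnd ℂ) (z k) ^ β k :=
  (Finset.mul_prod_erase _ _ (Finset.mem_univ j)).symm

theorem hasDerivAt_monom (α β : Fin m → ℕ) (j : Fin m) (c : ℂ) (z : Fin m → ℂ) :
    HasDerivAt (fun t : ℝ => monom α β (z + t • (Pi.single j c : Fin m → ℂ)))
      ((α j * z j ^ (α j - 1) * c * (starRingEnd ℂ) (z j) ^ β j +
        z j ^ α j * (β j * (starRingEnd ℂ) (z j) ^ (β j - 1) * (starRingEnd ℂ) c)) *
      ∏ k ∈ Finset.univ.erase j, z k ^ α k * (starRingEnd ℂ) (z k) ^ β k) 0 := by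
  have h : ∀ t : ℝ, monom α β (z + t • (Pi.single j c : Fin m → ℂ)) =
      ((z + t • (Pi.single j c : Fin m → ℂ)) j ^ α j *
        (starRingEnd ℂ) ((z + t • (Pi.single j c : Fin m → ℂ)) j) ^ β j) *
      ∏ k ∈ Finset.univ.erase j, z k ^ α k * (starRingEnd ℂ) (z k) ^ β k := by
    intro t
    rw [monom_eq_mul_prod_erase α β j]
    congr 1
    refine Finset.prod_congr rfl fun k hk => ?_
    simp [Finset.ne_of_mem_erase hk]
  simp only [h]
  have h1 := (hasDerivAt_coord z (Pi.single j c) j).fun_pow (α j)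
  have h2 := (hasDerivAt_conj_coord z (Pi.single j c) j).fun_pow (β j)
  simpa using (h1.fun_mul h2).mul_const _

theorem hasPzc_monom (α β : Fin m → ℕ) (j : Fin m) (x : Cl n) (z : Fin m → ℂ) :
    HasPzc j (fun w => monom α β w • x) z
      ((β j * monom α (β - Pi.single j 1) z) • x) := by
  have hx : HasPzc j (fun _ : Fin m → ℂ => x) z 0 := by
    have h : ∀ v : Fin m → ℂ, HasDirDeriv (fun _ : Fin m → ℂ => x) z v 0 := fun v φ => by
      simpa using hasDerivAt_const (0 : ℝ) (φ x)
    exact ⟨0, 0, h _, h _, by simp⟩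
  convert hx.smul_fun (hasDerivAt_monom α β j 1 z) (hasDerivAt_monom α β j Complex.I z) using 1
  rw [smul_zero, add_zero]
  congr 1
  rw [monom_eq_mul_prod_erase α _ j]
  have hprod : ∏ k ∈ Finset.univ.erase j,
      z k ^ α k * (starRingEnd ℂ) (z k) ^ (β - Pi.single j 1 : Fin m → ℕ) k =
      ∏ k ∈ Finset.univ.erase j, z k ^ α k * (starRingEnd ℂ) (z k) ^ β k :=
    Finset.prod_congr rfl fun k hk => by simp [Finset.ne_of_mem_erase hk]
  rw [hprod]
  simp only [Pi.sub_apply, Pi.single_eq_same, map_one, Complex.conj_I]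
  linear_combination (-2⁻¹ * (α j * z j ^ (α j - 1) * (starRingEnd ℂ) (z j) ^ β j -
    z j ^ α j * (β j * (starRingEnd ℂ) (z j) ^ (β j - 1))) *
      ∏ k ∈ Finset.univ.erase j, z k ^ α k * (starRingEnd ℂ) (z k) ^ β k) * Complex.I_mul_I

end Derivatives

section BihomogeneousPolynomials

variable {n m : ℕ}

/-- Span of the monomial maps `z ↦ z^α conj(z)^β x` with `|α| = a` and `|β| = b`. -/
def bihomPoly (n m a b : ℕ) : Submodule ℂ ((Fin m → ℂ) → Cl n) :=
  Submodule.span ℂ {f | ∃ (α β : Fin m → ℕ) (x : Cl n), ∑ j, α j = a ∧ ∑ j, β j = b ∧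
    f = fun z => monom α β z • x}

theorem monom_smul_mem_bihomPoly {a b : ℕ} {α β : Fin m → ℕ} (hα : ∑ j, α j = a)
    (hβ : ∑ j, β j = b) (x : Cl n) : (fun z => monom α β z • x) ∈ bihomPoly n m a b :=
  Submodule.subset_span ⟨α, β, x, hα, hβ, rfl⟩

theorem monom_smul (α β : Fin m → ℕ) (c : ℂ) (z : Fin m → ℂ) :
    monom α β (c • z) =
      c ^ (∑ j, α j) * (starRingEnd ℂ) c ^ (∑ j, β j) * monom α β z := by
  simp only [monom, Pi.smul_apply, smul_eq_mul, map_mul, mul_pow, Finset.prod_mul_distrib,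
    Finset.prod_pow_eq_pow_sum]
  ring

/-- A polynomial in two variables vanishing at all `(c, conj c)` is zero. -/
theorem mvPolynomial_eq_zero_of_eval_conj (F : MvPolynomial (Fin 2) ℂ)
    (h : ∀ c : ℂ, MvPolynomial.eval ![c, (starRingEnd ℂ) c] F = 0) : F = 0 := by
  set G : MvPolynomial (Fin 2) ℂ := MvPolynomial.bind₁
    ![MvPolynomial.X 0 + MvPolynomial.C Complex.I * MvPolynomial.X 1,
      MvPolynomial.X 0 - MvPolynomial.C Complex.I * MvPolynomial.X 1] F with hG
  have heval : ∀ x : Fin 2 → ℂ, MvPolynomial.eval x G =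
      MvPolynomial.eval ![x 0 + Complex.I * x 1, x 0 - Complex.I * x 1] F := by
    intro x
    rw [hG, ← MvPolynomial.coe_aeval_eq_eval, ← MvPolynomial.coe_aeval_eq_eval]
    simp only [RingHom.coe_coe, MvPolynomial.aeval_bind₁]
    congr 2
    funext i
    fin_cases i <;> simp
  have hG0 : G = 0 := by
    refine MvPolynomial.funext_set (fun _ => Set.range ((↑) : ℝ → ℂ))
      (fun _ => Set.infinite_range_of_injective Complex.ofReal_injective) fun x hx => ?_
    obtain ⟨s, hs⟩ := hx 0 (Set.mem_univ _)
    obtain ⟨t, ht⟩ := hx 1 (Set.mem_univ _)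
    rw [heval, map_zero, ← hs, ← ht, ← h (s + Complex.I * t)]
    congr 2
    simp [sub_eq_add_neg]
  refine MvPolynomial.funext fun x => ?_
  have := heval ![(x 0 + x 1) / 2, (x 0 - x 1) / (2 * Complex.I)]
  rw [hG0, map_zero] at this
  rw [map_zero, this]
  congr 2
  have hI := Complex.I_ne_zero
  funext i
  fin_cases i <;> simp <;> field_simp <;> ring

theorem sum_filter_eq_of_bihom {N a b : ℕ} (k l : Fin N → ℕ) (A : Fin N → ℂ) (P : ℂ)
    (h : ∀ c : ℂ, ∑ t, c ^ k t * (starRingEnd ℂ) c ^ l t * A t =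
      c ^ a * (starRingEnd ℂ) c ^ b * P) :
    ∑ t with k t = a ∧ l t = b, A t = P := by
  let d : ℕ → ℕ → Fin 2 →₀ ℕ := fun i j => Finsupp.single 0 i + Finsupp.single 1 j
  have hd : ∀ i j i' j', d i j = d i' j' ↔ i = i' ∧ j = j' := by
    intro i j i' j'
    refine ⟨fun h => ⟨?_, ?_⟩, fun ⟨h₁, h₂⟩ => by rw [h₁, h₂]⟩
    · simpa [d] using DFunLike.congr_fun h 0
    · simpa [d] using DFunLike.congr_fun h 1
  have heval : ∀ i j B c, MvPolynomial.eval ![c, (starRingEnd ℂ) c]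
      (MvPolynomial.monomial (d i j) B) = c ^ i * (starRingEnd ℂ) c ^ j * B := by
    intro i j B c
    rw [MvPolynomial.eval_monomial, Finsupp.prod_fintype _ _ (by simp)]
    simp [d, mul_comm]
  have hF := mvPolynomial_eq_zero_of_eval_conj
    (∑ t, MvPolynomial.monomial (d (k t) (l t)) (A t) - MvPolynomial.monomial (d a b) P)
    (fun c => by simp only [map_sub, map_sum, heval, h, sub_self])
  have hc := congr_arg (MvPolynomial.coeff (d a b)) hF
  simp only [MvPolynomial.coeff_sub, MvPolynomial.coeff_sum, MvPolynomial.coeff_monomial, hd,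
    MvPolynomial.coeff_zero, if_true] at hc
  rw [Finset.sum_filter]
  exact sub_eq_zero.mp hc

theorem isBihom_iff_mem_bihomPoly {a b : ℕ} {p : (Fin m → ℂ) → Cl n} :
    IsBihom n m a b p ↔ p ∈ bihomPoly n m a b := by
  constructor
  · rintro ⟨⟨N, c, dx, dy, hp⟩, hhom⟩
    have hsum : p = ∑ t with ∑ j, dx t j = a ∧ ∑ j, dy t j = b,
        fun z => monom (dx t) (dy t) z • c t := by
      funext z
      rw [← sub_eq_zero, ← Module.forall_dual_apply_eq_zero_iff ℂ]
      intro φ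
      rw [map_sub, sub_eq_zero, Finset.sum_apply, map_sum]
      refine (sum_filter_eq_of_bihom _ _ (fun t => φ (monom (dx t) (dy t) z • c t)) _
        fun s => ?_).symm
      have h1 := congr_arg φ ((hp (s • z)).symm.trans (hhom s z))
      rw [map_sum, map_smul, smul_eq_mul] at h1
      rw [← h1]
      refine Finset.sum_congr rfl fun t _ => ?_
      change _ = φ (monom (dx t) (dy t) (s • z) • c t)
      rw [monom_smul, map_smul, map_smul, smul_eq_mul, smul_eq_mul, mul_assoc _ (monom _ _ _)]
    rw [hsum]
    refine Submodule.sum_mem _ fun t ht => ?_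
    rw [Finset.mem_filter] at ht
    exact monom_smul_mem_bihomPoly ht.2.1 ht.2.2 _
  · intro h
    obtain ⟨N, s, g, rfl⟩ := Submodule.mem_span_set'.mp h
    choose α β x hα hβ hg using fun i => (g i).2
    have hval : ∀ z, (∑ i, s i • (g i : (Fin m → ℂ) → Cl n)) z =
        ∑ i, monom (α i) (β i) z • s i • x i := by
      intro z
      rw [Finset.sum_apply]
      refine Finset.sum_congr rfl fun i _ => ?_
      rw [Pi.smul_apply, hg i, smul_comm]
    refine ⟨⟨N, fun i => s i • x i, α, β, hval⟩, fun c z => ?_⟩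
    rw [hval, hval, Finset.smul_sum]
    refine Finset.sum_congr rfl fun i _ => ?_
    rw [monom_smul, hα, hβ, mul_smul]

theorem bihomPoly_induction {a b : ℕ} {P : ((Fin m → ℂ) → Cl n) → Prop} (hzero : P 0)
    (hadd : ∀ f g, f ∈ bihomPoly n m a b → g ∈ bihomPoly n m a b → P f → P g → P (f + g))
    (hsmul : ∀ (c : ℂ) f, f ∈ bihomPoly n m a b → P f → P (c • f))
    (hmonom : ∀ (α β : Fin m → ℕ) (x : Cl n), ∑ j, α j = a → ∑ j, β j = b →
      P fun z => monom α β z • x) {f : (Fin m → ℂ) → Cl n} (hf : f ∈ bihomPoly n m a b) : P f := by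
  induction hf using Submodule.span_induction with
  | mem f hf =>
    obtain ⟨α, β, x, hα, hβ, rfl⟩ := hf
    exact hmonom α β x hα hβ
  | zero => exact hzero
  | add f g hf' hg' hf hg => exact hadd f g hf' hg' hf hg
  | smul c f hf' hf => exact hsmul c f hf' hf

theorem hasPzc_of_mem_bihomPoly {a b : ℕ} {f : (Fin m → ℂ) → Cl n} (hf : f ∈ bihomPoly n m a b)
    (j : Fin m) (z : Fin m → ℂ) : HasPzc j f z (pzc j f z) := by
  suffices h : ∃ d, HasPzc j f z d by
    obtain ⟨d, hd⟩ := h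
    rwa [hd.pzc_eq]
  refine bihomPoly_induction (P := fun f => ∃ d, HasPzc j f z d) ⟨0, HasPzc.zero j z⟩
    ?_ ?_ ?_ hf
  · rintro f g - - ⟨d, hd⟩ ⟨d', hd'⟩
    exact ⟨_, hd.add hd'⟩
  · rintro c f - ⟨d, hd⟩
    exact ⟨_, hd.smul c⟩
  · intro α β x _ _
    exact ⟨_, hasPzc_monom α β j x z⟩

theorem pzc_zero (j : Fin m) : pzc j (0 : (Fin m → ℂ) → Cl n) = 0 :=
  funext fun z => (HasPzc.zero j z).pzc_eq

theorem pzc_add {a b : ℕ} {f g : (Fin m → ℂ) → Cl n} (hf : f ∈ bihomPoly n m a b)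
    (hg : g ∈ bihomPoly n m a b) (j : Fin m) : pzc j (f + g) = pzc j f + pzc j g :=
  funext fun z =>
    ((hasPzc_of_mem_bihomPoly hf j z).add (hasPzc_of_mem_bihomPoly hg j z)).pzc_eq

theorem pzc_smul {a b : ℕ} {f : (Fin m → ℂ) → Cl n} (hf : f ∈ bihomPoly n m a b) (c : ℂ)
    (j : Fin m) : pzc j (c • f) = c • pzc j f :=
  funext fun z => ((hasPzc_of_mem_bihomPoly hf j z).smul c).pzc_eq

theorem pzc_monom (α β : Fin m → ℕ) (x : Cl n) (j : Fin m) :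
    pzc j (fun z => monom α β z • x) =
      fun z => monom α (β - Pi.single j 1) z • (β j : ℂ) • x := by
  funext z
  rw [(hasPzc_monom α β j x z).pzc_eq, smul_smul, mul_comm]

theorem pzc_mem_bihomPoly {a b : ℕ} {f : (Fin m → ℂ) → Cl n} (hf : f ∈ bihomPoly n m a b)
    (j : Fin m) : pzc j f ∈ bihomPoly n m a (b - 1) := by
  refine bihomPoly_induction (P := fun f => pzc j f ∈ bihomPoly n m a (b - 1)) ?_ ?_ ?_ ?_ hf
  · rw [pzc_zero]
    exact zero_mem _
  · intro f g hf hg hf' hg'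
    rw [pzc_add hf hg]
    exact add_mem hf' hg'
  · intro c f hf hf'
    rw [pzc_smul hf]
    exact Submodule.smul_mem _ _ hf'
  · intro α β x hα hβ
    rw [pzc_monom]
    by_cases h : β j = 0
    · simp only [h, Nat.cast_zero, zero_smul, smul_zero]
      exact zero_mem _
    · refine monom_smul_mem_bihomPoly hα ?_ _
      have hle : ∀ k ∈ Finset.univ, (Pi.single j 1 : Fin m → ℕ) k ≤ β k := by
        intro k _
        by_cases hk : k = j
        · subst hk
          simpa using Nat.one_le_iff_ne_zero.mpr h
        · simp [hk]
      simp only [Pi.sub_apply]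
      rw [Finset.sum_tsub_distrib _ hle, hβ]
      simp

theorem pzc_comm {a b : ℕ} {f : (Fin m → ℂ) → Cl n} (hf : f ∈ bihomPoly n m a b) (j k : Fin m) :
    pzc j (pzc k f) = pzc k (pzc j f) := by
  refine bihomPoly_induction (P := fun f => pzc j (pzc k f) = pzc k (pzc j f)) ?_ ?_ ?_ ?_ hf
  · simp only [pzc_zero]
  · intro f g hf hg hf' hg'
    rw [pzc_add hf hg, pzc_add hf hg,
      pzc_add (pzc_mem_bihomPoly hf k) (pzc_mem_bihomPoly hg k),
      pzc_add (pzc_mem_bihomPoly hf j) (pzc_mem_bihomPoly hg j), hf', hg']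
  · intro c f hf hf'
    rw [pzc_smul hf, pzc_smul hf, pzc_smul (pzc_mem_bihomPoly hf k),
      pzc_smul (pzc_mem_bihomPoly hf j), hf']
  · intro α β x _ _
    by_cases hjk : j = k
    · rw [hjk]
    · simp only [pzc_monom, tsub_right_comm (a := β) (b := Pi.single k 1), Pi.sub_apply,
        Pi.single_eq_of_ne hjk, Pi.single_eq_of_ne (Ne.symm hjk), tsub_zero,
        smul_comm (β j : ℂ)]

theorem conj_mul_monom (α β : Fin m → ℕ) (j : Fin m) (z : Fin m → ℂ) :
    (starRingEnd ℂ) (z j) * monom α β z = monom α (β + Pi.single j 1) z := by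
  rw [monom_eq_mul_prod_erase α β j, monom_eq_mul_prod_erase α _ j]
  have hprod : ∏ k ∈ Finset.univ.erase j,
      z k ^ α k * (starRingEnd ℂ) (z k) ^ (β + Pi.single j 1 : Fin m → ℕ) k =
      ∏ k ∈ Finset.univ.erase j, z k ^ α k * (starRingEnd ℂ) (z k) ^ β k :=
    Finset.prod_congr rfl fun k hk => by simp [Finset.ne_of_mem_erase hk]
  rw [hprod, Pi.add_apply, Pi.single_eq_same, pow_succ]
  ring

/-- Euler's formula for the conjugate variables. -/
theorem sum_conj_smul_pzc {a b : ℕ} {f : (Fin m → ℂ) → Cl n} (hf : f ∈ bihomPoly n m a b)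
    (z : Fin m → ℂ) : ∑ j, (starRingEnd ℂ) (z j) • pzc j f z = (b : ℂ) • f z := by
  refine bihomPoly_induction
    (P := fun f => ∑ j, (starRingEnd ℂ) (z j) • pzc j f z = (b : ℂ) • f z) ?_ ?_ ?_ ?_ hf
  · simp [pzc_zero]
  · intro f g hf hg hf' hg'
    simp only [pzc_add hf hg, Pi.add_apply, smul_add, Finset.sum_add_distrib, hf', hg']
  · intro c f hf hf'
    simp only [pzc_smul hf, Pi.smul_apply, smul_comm _ c, ← Finset.smul_sum, hf']
  · intro α β x _ hβ
    have hterm : ∀ j, (starRingEnd ℂ) (z j) • monom α (β - Pi.single j 1) z • (β j : ℂ) • x =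
        (β j : ℂ) • monom α β z • x := by
      intro j
      by_cases h : β j = 0
      · simp [h]
      · have hle : (Pi.single j 1 : Fin m → ℕ) ≤ β := by
          intro k
          by_cases hk : k = j
          · subst hk
            simpa using Nat.one_le_iff_ne_zero.mpr h
          · simp [hk]
        rw [smul_smul, conj_mul_monom, tsub_add_cancel_of_le hle, smul_comm]
    simp only [pzc_monom, hterm, ← Finset.sum_smul]
    rw [← Nat.cast_sum, hβ]

theorem mul_left_mem_bihomPoly {a b : ℕ} {f : (Fin m → ℂ) → Cl n} (hf : f ∈ bihomPoly n m a b)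
    (x : Cl n) : (fun z => x * f z) ∈ bihomPoly n m a b := by
  refine bihomPoly_induction (P := fun f => (fun z => x * f z) ∈ bihomPoly n m a b) ?_ ?_ ?_ ?_ hf
  · simp only [Pi.zero_apply, mul_zero]
    exact zero_mem _
  · intro f g _ _ hf' hg'
    simp only [Pi.add_apply, mul_add]
    exact add_mem hf' hg'
  · intro c f _ hf'
    simp only [Pi.smul_apply, mul_smul_comm]
    exact Submodule.smul_mem _ c hf'
  · intro α β y hα hβ
    simp only [mul_smul_comm]
    exact monom_smul_mem_bihomPoly hα hβ _

theorem conj_smul_mem_bihomPoly {a b : ℕ} {f : (Fin m → ℂ) → Cl n} (hf : f ∈ bihomPoly n m a b)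
    (j : Fin m) : (fun z => (starRingEnd ℂ) (z j) • f z) ∈ bihomPoly n m a (b + 1) := by
  refine bihomPoly_induction
    (P := fun f => (fun z => (starRingEnd ℂ) (z j) • f z) ∈ bihomPoly n m a (b + 1)) ?_ ?_ ?_ ?_ hf
  · simp only [Pi.zero_apply, smul_zero]
    exact zero_mem _
  · intro f g _ _ hf' hg'
    simp only [Pi.add_apply, smul_add]
    exact add_mem hf' hg'
  · intro c f _ hf'
    simp only [Pi.smul_apply, smul_comm _ c]
    exact Submodule.smul_mem _ c hf'
  · intro α β y hα hβ
    simp only [smul_smul, conj_mul_monom]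
    refine monom_smul_mem_bihomPoly hα ?_ _
    simp [Finset.sum_add_distrib, hβ]

end BihomogeneousPolynomials

section FischerOperators

variable {n : ℕ}

/-- Left multiplication by `z̲̃†(z) = ∑_{j<n} 𝔣_j† conj(z_j)`. -/
def zdMul (n : ℕ) (f : (Fin (n - 1) → ℂ) → Cl n) (z : Fin (n - 1) → ℂ) : Cl n :=
  (∑ j : Fin (n - 1), (starRingEnd ℂ) (z j) • ffd n (Fin.castLE (Nat.sub_le n 1) j)) * f z

theorem zdMul_eq_sum (f : (Fin (n - 1) → ℂ) → Cl n) :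
    zdMul n f = ∑ j : Fin (n - 1),
      fun z => (starRingEnd ℂ) (z j) • (ffd n (Fin.castLE (Nat.sub_le n 1) j) * f z) := by
  funext z
  simp only [zdMul, Finset.sum_mul, Finset.sum_apply, smul_mul_assoc]

theorem dzdT_eq_sum (f : (Fin (n - 1) → ℂ) → Cl n) :
    dzdT n f = ∑ j : Fin (n - 1),
      fun z => ff n (Fin.castLE (Nat.sub_le n 1) j) * pzc j f z := by
  funext z
  simp only [dzdT, Finset.sum_apply]

theorem dzdT_add {a b : ℕ} {f g : (Fin (n - 1) → ℂ) → Cl n} (hf : f ∈ bihomPoly n (n - 1) a b)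
    (hg : g ∈ bihomPoly n (n - 1) a b) : dzdT n (f + g) = dzdT n f + dzdT n g := by
  funext z
  simp only [dzdT, pzc_add hf hg, Pi.add_apply, mul_add, Finset.sum_add_distrib]

theorem dzdT_smul {a b : ℕ} {f : (Fin (n - 1) → ℂ) → Cl n} (hf : f ∈ bihomPoly n (n - 1) a b)
    (c : ℂ) : dzdT n (c • f) = c • dzdT n f := by
  funext z
  simp only [dzdT, pzc_smul hf, Pi.smul_apply, mul_smul_comm, ← Finset.smul_sum]

theorem dzdT_mem_bihomPoly {a b : ℕ} {f : (Fin (n - 1) → ℂ) → Cl n}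
    (hf : f ∈ bihomPoly n (n - 1) a b) : dzdT n f ∈ bihomPoly n (n - 1) a (b - 1) := by
  rw [dzdT_eq_sum]
  exact Submodule.sum_mem _ fun j _ => mul_left_mem_bihomPoly (pzc_mem_bihomPoly hf j) _

theorem zdMul_mem_bihomPoly {a b : ℕ} {f : (Fin (n - 1) → ℂ) → Cl n}
    (hf : f ∈ bihomPoly n (n - 1) a b) : zdMul n f ∈ bihomPoly n (n - 1) a (b + 1) := by
  rw [zdMul_eq_sum]
  exact Submodule.sum_mem _ fun j _ => conj_smul_mem_bihomPoly (mul_left_mem_bihomPoly hf _) j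

theorem dzdT_mem_LamQ {a b r : ℕ} {f : (Fin (n - 1) → ℂ) → Cl n}
    (hf : f ∈ bihomPoly n (n - 1) a b) (hval : ∀ z, f z ∈ LamQ n r) (z : Fin (n - 1) → ℂ) :
    dzdT n f z ∈ LamQ n (r - 1) :=
  Submodule.sum_mem _ fun j _ =>
    ff_mul_mem_LamQ (by rw [Fin.val_castLE]; omega) ((hasPzc_of_mem_bihomPoly hf j z).mem hval)

theorem zdMul_mem_LamQ {r : ℕ} {f : (Fin (n - 1) → ℂ) → Cl n} (hval : ∀ z, f z ∈ LamQ n r)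
    (z : Fin (n - 1) → ℂ) : zdMul n f z ∈ LamQ n (r + 1) := by
  rw [zdMul_eq_sum, Finset.sum_apply]
  exact Submodule.sum_mem _ fun j _ => Submodule.smul_mem _ _ (ffd_mul_mem_LamQ _ (hval z))

theorem dzdT_dzdT {a b : ℕ} {f : (Fin (n - 1) → ℂ) → Cl n} (hf : f ∈ bihomPoly n (n - 1) a b) :
    dzdT n (dzdT n f) = 0 := by
  have hpzc : ∀ j z, pzc j (dzdT n f) z =
      ∑ k, ff n (Fin.castLE (Nat.sub_le n 1) k) * pzc k (pzc j f) z := by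
    intro j z
    rw [dzdT_eq_sum, (HasPzc.sum _ fun k _ =>
      (hasPzc_of_mem_bihomPoly (pzc_mem_bihomPoly hf k) j z).mul_left
        (ff n (Fin.castLE (Nat.sub_le n 1) k))).pzc_eq]
    exact Finset.sum_congr rfl fun k _ => by rw [pzc_comm hf]
  funext z
  refine eq_zero_of_add_self ?_
  have h : dzdT n (dzdT n f) z = ∑ j, ∑ k, (ff n (Fin.castLE (Nat.sub_le n 1) j) *
      ff n (Fin.castLE (Nat.sub_le n 1) k)) * pzc k (pzc j f) z := by
    rw [dzdT]
    refine Finset.sum_congr rfl fun j _ => ?_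
    rw [hpzc, Finset.mul_sum]
    simp only [mul_assoc]
  rw [h]
  nth_rw 2 [Finset.sum_comm]
  simp only [← Finset.sum_add_distrib]
  refine Finset.sum_eq_zero fun j _ => Finset.sum_eq_zero fun k _ => ?_
  rw [pzc_comm hf j k, ← add_mul, ff_mul_ff_add, zero_mul]

theorem dzdT_zdMul_add {a b r : ℕ} {f : (Fin (n - 1) → ℂ) → Cl n}
    (hf : f ∈ bihomPoly n (n - 1) a b) (hval : ∀ z, f z ∈ LamQ n r) :
    dzdT n (zdMul n f) + zdMul n (dzdT n f) = ((n - r + b : ℕ) : ℂ) • f := by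
  funext z
  have hpzc : ∀ j, pzc j (zdMul n f) z = ffd n (Fin.castLE (Nat.sub_le n 1) j) * f z +
      ∑ k, (starRingEnd ℂ) (z k) • (ffd n (Fin.castLE (Nat.sub_le n 1) k) * pzc j f z) := by
    intro j
    rw [zdMul_eq_sum, (HasPzc.sum _ fun k _ =>
      ((hasPzc_of_mem_bihomPoly hf j z).mul_left
        (ffd n (Fin.castLE (Nat.sub_le n 1) k))).conj_smul k).pzc_eq, Finset.sum_add_distrib]
    simp
  have h1 : dzdT n (zdMul n f) z = (n - r) • f z +
      ∑ j, ∑ k, (starRingEnd ℂ) (z k) • (ff n (Fin.castLE (Nat.sub_le n 1) j) *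
        ffd n (Fin.castLE (Nat.sub_le n 1) k) * pzc j f z) := by
    rw [dzdT]
    simp only [hpzc, mul_add, Finset.sum_add_distrib, Finset.mul_sum, mul_smul_comm, mul_assoc]
    rw [sum_ff_mul_ffd_mul (hval z)]
  have h2 : zdMul n (dzdT n f) z =
      ∑ j, ∑ k, (starRingEnd ℂ) (z k) • (ffd n (Fin.castLE (Nat.sub_le n 1) k) *
        ff n (Fin.castLE (Nat.sub_le n 1) j) * pzc j f z) := by
    rw [zdMul_eq_sum, Finset.sum_comm]
    simp only [Finset.sum_apply, dzdT, Finset.mul_sum, Finset.smul_sum, mul_assoc]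
  have h3 : ∀ j k : Fin (n - 1), (starRingEnd ℂ) (z k) • (ff n (Fin.castLE (Nat.sub_le n 1) j) *
        ffd n (Fin.castLE (Nat.sub_le n 1) k) * pzc j f z) +
      (starRingEnd ℂ) (z k) • (ffd n (Fin.castLE (Nat.sub_le n 1) k) *
        ff n (Fin.castLE (Nat.sub_le n 1) j) * pzc j f z) =
      if j = k then (starRingEnd ℂ) (z k) • pzc j f z else 0 := by
    intro j k
    rw [← smul_add, ← add_mul, ff_mul_ffd_add]
    simp only [Fin.castLE_inj]
    split_ifs <;> simp
  rw [Pi.add_apply, Pi.smul_apply, h1, h2, add_assoc, ← Finset.sum_add_distrib]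
  simp only [← Finset.sum_add_distrib, h3, Finset.sum_ite_eq, Finset.mem_univ, if_true]
  rw [sum_conj_smul_pzc hf, Nat.cast_add, add_smul, Nat.cast_smul_eq_nsmul ℂ (n - r)]

end FischerOperators

/-- **Fischer decomposition for `∂_z̃†` (Proposition 5.2):**
`𝒬_{a,b,r} = (Ker ∂_z̃† ∩ 𝒬_{a,b,r}) ⊕ z̲̃† (Ker ∂_z̃† ∩ 𝒬_{a,b-1,r-1})`, i.e. every
`p ∈ 𝒬_{a,b,r}` decomposes uniquely as `p = y + z̲̃† q` with `y ∈ 𝒬_{a,b,r}`, `∂_z̃† y = 0`,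
`q ∈ 𝒬_{a,b-1,r-1}`, `∂_z̃† q = 0`, where `z̲̃†(z) = ∑_{j<n} 𝔣_j† conj(z_j)`. -/
theorem fischer_decomposition_dzd (n : ℕ) (hn : 2 ≤ n) (a b r : ℕ) (hb : 1 ≤ b)
    (hr2 : 2 ≤ r) (hrn : r ≤ n)
    (p : (Fin (n - 1) → ℂ) → Cl n)
    (hpoly : IsBihom n (n - 1) a b p)
    (hval : ∀ z, p z ∈ LamQ n r) :
    ∃! yq : ((Fin (n - 1) → ℂ) → Cl n) × ((Fin (n - 1) → ℂ) → Cl n),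
      IsBihom n (n - 1) a b yq.1 ∧ (∀ z, yq.1 z ∈ LamQ n r) ∧ (∀ z, dzdT n yq.1 z = 0) ∧
      IsBihom n (n - 1) a (b - 1) yq.2 ∧ (∀ z, yq.2 z ∈ LamQ n (r - 1)) ∧
      (∀ z, dzdT n yq.2 z = 0) ∧
      (∀ z, p z =
        yq.1 z + (∑ j : Fin (n - 1),
          (starRingEnd ℂ) (z j) • ffd n (Fin.castLE (Nat.sub_le n 1) j)) * yq.2 z) := by
  obtain ⟨b, rfl⟩ := Nat.exists_eq_add_of_le' hb
  obtain ⟨r, rfl⟩ := Nat.exists_eq_add_of_le' (one_le_two.trans hr2)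
  rw [isBihom_iff_mem_bihomPoly] at hpoly
  simp only [isBihom_iff_mem_bihomPoly, Nat.add_sub_cancel]
  set K : ℂ := ((n - (r + 1) + (b + 1) : ℕ) : ℂ) with hK
  have hK0 : K ≠ 0 := Nat.cast_ne_zero.mpr (by omega)
  have hDp := dzdT_mem_bihomPoly hpoly
  have hXp := zdMul_mem_bihomPoly hpoly
  have hDXp := dzdT_mem_bihomPoly hXp
  have hFischer := dzdT_zdMul_add hpoly hval
  rw [← hK] at hFischer
  simp only [Nat.add_sub_cancel] at hDp hDXp
  refine ⟨(K⁻¹ • dzdT n (zdMul n p), K⁻¹ • dzdT n p),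
    ⟨Submodule.smul_mem _ _ hDXp,
      fun z => Submodule.smul_mem _ _ (dzdT_mem_LamQ hXp (zdMul_mem_LamQ hval) z),
      fun z => ?_, Submodule.smul_mem _ _ hDp,
      fun z => Submodule.smul_mem _ _ (dzdT_mem_LamQ hpoly hval z), fun z => ?_, fun z => ?_⟩, ?_⟩
  · rw [dzdT_smul hDXp, dzdT_dzdT hXp, smul_zero, Pi.zero_apply]
  · rw [dzdT_smul hDp, dzdT_dzdT hpoly, smul_zero, Pi.zero_apply]
  · have h := congr_fun hFischer z
    rw [Pi.add_apply, Pi.smul_apply, zdMul] at h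
    simp only [Pi.smul_apply, mul_smul_comm]
    rw [← smul_add, h, inv_smul_smul₀ hK0]
  · rintro ⟨y, q⟩ ⟨hy, -, hDy, hq, hqval, hDq, hp⟩
    have hpyq : p = y + zdMul n q := funext hp
    have hDy0 : dzdT n y = 0 := funext hDy
    have hDq0 : dzdT n q = 0 := funext hDq
    have hX0 : zdMul n (0 : (Fin (n - 1) → ℂ) → Cl n) = 0 := by
      funext z
      simp [zdMul]
    have hDXq := dzdT_zdMul_add hq hqval
    rw [hDq0, hX0, add_zero, show n - r + b = n - (r + 1) + (b + 1) by omega, ← hK] at hDXq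
    have hDp_eq : dzdT n p = K • q := by
      rw [hpyq, dzdT_add hy (zdMul_mem_bihomPoly hq), hDy0, zero_add, hDXq]
    have hXDp : zdMul n (dzdT n p) = K • zdMul n q := by
      funext z
      simp only [hDp_eq, zdMul, Pi.smul_apply, mul_smul_comm]
    have hDXp_eq : dzdT n (zdMul n p) = K • y := by
      rw [eq_sub_of_add_eq hFischer, hXDp, ← smul_sub, hpyq, add_sub_cancel_right]
    rw [hDp_eq, hDXp_eq, inv_smul_smul₀ hK0, inv_smul_smul₀ hK0]
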